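/- Let d ≥ 2 and suppose f(x) ∈ ℚ((x^{-1})) satisfies the functional equation with P(0)=1 and g = x^{-1}f is badly approximable with all convergents p_n/q_n. If for some n₀ ≥ 1 the rational function p_{n₀}/q_{n₀} (with integer-coefficient p_{n₀}, q_{n₀}, deg q_{n₀} = n₀) approximates g with rate c ≥ 2, i.e. ||g(x) - p_{n₀}(x)/q_{n₀}(x)|| ≤ -2n₀ - c, and b ≥ 2 is an integer with g(b) ≠ 0 and P(b^{-d^t}) ≠ 0 for all t ≥ 0, then the irrationality exponent of the real number g(b) satisfies μ(g(b)) ≥ 2 + (c-1)/n₀. -/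

import Mathlib

open Polynomial
open scoped Classical

noncomputable section

/-- The infinite product `∏_{t=0}^∞ P(T^{d^t})` (with `T = x⁻¹`), defined coefficientwise
via the stabilizing finite truncated products (valid when `P(0) = 1`). -/
def infProd (P : Polynomial ℚ) (d : ℕ) : PowerSeries ℚ :=
  PowerSeries.mk fun n => (∏ t ∈ Finset.range (n + 1), P.comp (Polynomial.X ^ d ^ t)).coeff n

/-- The element `x = T⁻¹` of `ℚ((T))`. -/
def xx : LaurentSeries ℚ := ((PowerSeries.X : PowerSeries ℚ) : LaurentSeries ℚ)⁻¹

/-- Evaluation of a polynomial in the variable `x` inside `ℚ((x⁻¹))`. -/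
def pev (p : Polynomial ℚ) : LaurentSeries ℚ := Polynomial.aeval (xx : LaurentSeries ℚ) p

/-- Degree valuation `‖f‖` on `ℚ((x⁻¹))`, with `‖0‖ = ⊥`. -/
def degB (f : LaurentSeries ℚ) : WithBot ℤ := if f = 0 then ⊥ else (-(f.order) : ℤ)

/-- The polynomial part of a Laurent series in `x⁻¹`. -/
def polyPart (f : LaurentSeries ℚ) : LaurentSeries ℚ :=
  ∑ i ∈ Finset.Icc f.order 0, HahnSeries.single i (f.coeff i)

/-- The complete quotients (tails) of the continued fraction algorithm for `f`. -/
def cfTail (f : LaurentSeries ℚ) : ℕ → LaurentSeries ℚ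
  | 0 => f
  | n + 1 => (cfTail f n - polyPart (cfTail f n))⁻¹

/-- The `n`-th partial quotient `a_n(x)` of the continued fraction of `f`. -/
def cfA (f : LaurentSeries ℚ) (n : ℕ) : LaurentSeries ℚ := polyPart (cfTail f n)

/-- The real number `g(b) = b⁻¹ ∏_{t=0}^∞ P(b^{-d^t})`. -/
def gval (P : Polynomial ℚ) (d : ℕ) (b : ℤ) : ℝ :=
  ((b : ℝ))⁻¹ * ∏' t : ℕ, (Polynomial.aeval (((b : ℝ))⁻¹ ^ d ^ t) P : ℝ)

/-- The truncated product `∏_{t < k} P(T^{d^t})`. -/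
def partialProd (P : Polynomial ℚ) (d k : ℕ) : Polynomial ℚ :=
  ∏ t ∈ Finset.range k, P.comp (X ^ d ^ t)

lemma X_pow_dvd_comp_X_pow_sub_one {P : Polynomial ℚ} (h0 : P.coeff 0 = 1) (m : ℕ) :
    X ^ m ∣ P.comp (X ^ m) - 1 := by
  have h : X ∣ P - 1 := by simp [X_dvd_iff, h0]
  obtain ⟨R, hR⟩ := h
  refine ⟨R.comp (X ^ m), ?_⟩
  have := congrArg (fun p => p.comp (X ^ m)) hR
  simpa using this

lemma coeff_partialProd_of_lt {P : Polynomial ℚ} {d : ℕ} (hd : 2 ≤ d) (h0 : P.coeff 0 = 1)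
    {n k : ℕ} (hk : n < k) :
    (partialProd P d k).coeff n = (partialProd P d (n + 1)).coeff n := by
  induction k, hk using Nat.le_induction with
  | base => rfl
  | succ k hk ih =>
    rw [← ih]
    obtain ⟨R, hR⟩ := X_pow_dvd_comp_X_pow_sub_one h0 (d ^ k)
    have hlt : n < d ^ k := lt_of_lt_of_le hk (Nat.lt_pow_self (by omega)).le
    have : partialProd P d (k + 1) = partialProd P d k + X ^ d ^ k * (partialProd P d k * R) := by
      rw [partialProd, Finset.prod_range_succ, ← partialProd, eq_add_of_sub_eq hR]
      ring
    rw [this, coeff_add, coeff_X_pow_mul', if_neg (by omega), add_zero]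

lemma coeff_infProd {P : Polynomial ℚ} {d : ℕ} (hd : 2 ≤ d) (h0 : P.coeff 0 = 1)
    {n k : ℕ} (hk : n < k) :
    PowerSeries.coeff n (infProd P d) = (partialProd P d k).coeff n := by
  rw [coeff_partialProd_of_lt hd h0 hk, infProd, PowerSeries.coeff_mk, partialProd]

lemma xx_ne_zero : xx ≠ 0 := by
  simp [xx]

lemma aeval_inv_xx (r : Polynomial ℚ) :
    aeval (xx⁻¹ : LaurentSeries ℚ) r = ((r : PowerSeries ℚ) : LaurentSeries ℚ) := by
  induction r using Polynomial.induction_on' with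
  | add p q hp hq => simp [hp, hq]
  | monomial n a =>
    rw [aeval_monomial, ← C_mul_X_pow_eq_monomial]
    simp [xx]

lemma pev_eq (r : Polynomial ℚ) {N : ℕ} (hN : r.natDegree ≤ N) :
    ((reflect N r : PowerSeries ℚ) : LaurentSeries ℚ) * xx ^ N = pev r := by
  let _ : Invertible xx := invertibleOfNonzero xx_ne_zero
  rw [← aeval_inv_xx, pev, aeval_def, aeval_def, ← eval₂_reflect_mul_pow _ xx N r hN]
  simp

lemma X_pow_dvd_of_degB_le {P : Polynomial ℚ} {d : ℕ} (hd : 2 ≤ d) (h0 : P.coeff 0 = 1)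
    {p q : Polynomial ℚ} (hq : q ≠ 0) {m : ℕ}
    (happ : degB (xx⁻¹ * ((infProd P d : PowerSeries ℚ) : LaurentSeries ℚ) - pev p / pev q) ≤
      ((-(m : ℤ) : ℤ) : WithBot ℤ))
    {N : ℕ} (hpN : p.natDegree ≤ N) (hqN : q.natDegree ≤ N) :
    X ^ (N - q.natDegree + m) ∣
      reflect N q * X * partialProd P d (N - q.natDegree + m) - reflect N p := by
  set F : PowerSeries ℚ := infProd P d with hF
  set h : LaurentSeries ℚ := xx⁻¹ * (F : LaurentSeries ℚ) - pev p / pev q with hh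
  set M := N - q.natDegree + m with hM
  set w : PowerSeries ℚ := (reflect N q : PowerSeries ℚ) * PowerSeries.X * F -
    (reflect N p : PowerSeries ℚ) with hw
  have hq' : reflect N q ≠ 0 := by simpa [reflect_eq_zero_iff] using hq
  have hqc : ((reflect N q : PowerSeries ℚ) : LaurentSeries ℚ) ≠ 0 := by
    rw [Ne, map_eq_zero_iff _ HahnSeries.ofPowerSeries_injective, Polynomial.coe_eq_zero_iff]
    exact hq'
  have hwh : (w : LaurentSeries ℚ) = ((reflect N q : PowerSeries ℚ) : LaurentSeries ℚ) * h := by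
    rw [hh, ← pev_eq p hpN, ← pev_eq q hqN,
      mul_div_mul_right _ _ (pow_ne_zero _ xx_ne_zero), mul_sub, mul_div_cancel₀ _ hqc, hw]
    simp only [PowerSeries.coe_sub, PowerSeries.coe_mul, xx, inv_inv]
    ring
  have hwM : ∀ i : ℕ, i < M → PowerSeries.coeff i w = 0 := by
    intro i hi
    rw [← LaurentSeries.coeff_coe_powerSeries, hwh]
    by_cases hz : h = 0
    · simp [hz]
    apply HahnSeries.coeff_eq_zero_of_lt_order
    rw [HahnSeries.order_mul hqc hz]
    have h1 : (m : ℤ) ≤ h.order := by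
      rw [degB, if_neg hz, WithBot.coe_le_coe] at happ
      omega
    have h2 : ((N - q.natDegree : ℕ) : ℤ) ≤
        ((reflect N q : PowerSeries ℚ) : LaurentSeries ℚ).order := by
      rw [HahnSeries.le_order_iff_forall hqc]
      intro j hj
      rw [PowerSeries.coeff_coe]
      split_ifs with hj0
      · rfl
      · rw [Polynomial.coeff_coe, coeff_reflect, revAt_le (by omega)]
        exact coeff_eq_zero_of_natDegree_lt (by omega)
    omega
  rw [X_pow_dvd_iff]
  intro i hi
  have hFM : PowerSeries.X ^ M ∣ F - (partialProd P d M : PowerSeries ℚ) := by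
    rw [PowerSeries.X_pow_dvd_iff]
    intro j hj
    rw [map_sub, hF, coeff_infProd hd h0 hj, Polynomial.coeff_coe, sub_self]
  rw [← Polynomial.coeff_coe]
  have : ((reflect N q * X * partialProd P d M - reflect N p : Polynomial ℚ) : PowerSeries ℚ) =
      w - (reflect N q : PowerSeries ℚ) * PowerSeries.X *
        (F - (partialProd P d M : PowerSeries ℚ)) := by
    rw [hw]
    push_cast
    ring
  rw [this, map_sub, hwM i hi, zero_sub, neg_eq_zero]
  exact PowerSeries.X_pow_dvd_iff.mp (hFM.mul_left _) i hi

lemma exists_forall_abs_aeval_le (R : Polynomial ℚ) :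
    ∃ C : ℝ, 0 ≤ C ∧ ∀ x : ℝ, 0 ≤ x → x ≤ 1 → |aeval x R| ≤ C := by
  obtain ⟨C, hC⟩ := (isCompact_Icc (a := (0 : ℝ)) (b := 1)).exists_bound_of_continuousOn
    (f := fun x => aeval x R) (R.continuous_aeval.continuousOn)
  exact ⟨C, (norm_nonneg _).trans (hC 0 (by simp)), fun x h0 h1 => hC x ⟨h0, h1⟩⟩

lemma exists_forall_abs_aeval_sub_one_le {P : Polynomial ℚ} (h0 : P.coeff 0 = 1) :
    ∃ A : ℝ, 0 ≤ A ∧ ∀ x : ℝ, 0 ≤ x → x ≤ 1 → |aeval x P - 1| ≤ A * x := by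
  obtain ⟨R, hR⟩ : X ∣ P - 1 := by simp [X_dvd_iff, h0]
  obtain ⟨A, hA, h⟩ := exists_forall_abs_aeval_le R
  refine ⟨A, hA, fun x hx0 hx1 => ?_⟩
  have := congrArg (aeval x) hR
  simp only [map_sub, map_one, map_mul, aeval_X] at this
  rw [this, abs_mul, abs_of_nonneg hx0, mul_comm]
  exact mul_le_mul_of_nonneg_right (h x hx0 hx1) hx0

/-- The real function `x ↦ ∏_{t=0}^∞ P(x^{d^t})`. -/
def prodFun (P : Polynomial ℚ) (d : ℕ) (x : ℝ) : ℝ := ∏' t : ℕ, (aeval (x ^ d ^ t) P : ℝ)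

lemma pow_pow_le_pow_succ {d : ℕ} (hd : 2 ≤ d) {x : ℝ} (hx0 : 0 ≤ x) (hx1 : x ≤ 1) (t : ℕ) :
    x ^ d ^ t ≤ x ^ (t + 1) :=
  pow_le_pow_of_le_one hx0 hx1 (Nat.lt_pow_self (by omega))

lemma multipliable_and_abs_prodFun_sub_one_le {P : Polynomial ℚ} {d : ℕ} (hd : 2 ≤ d)
    (h0 : P.coeff 0 = 1) :
    ∃ C : ℝ, 0 ≤ C ∧ ∀ x : ℝ, 0 ≤ x → x ≤ 1 / 2 →
      Multipliable (fun t : ℕ => (aeval (x ^ d ^ t) P : ℝ)) ∧ |prodFun P d x - 1| ≤ C * x := by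
  obtain ⟨A, hA, h⟩ := exists_forall_abs_aeval_sub_one_le h0
  refine ⟨2 * A * Real.exp A, by positivity, fun x hx0 hx1 => ?_⟩
  have hgeo : HasSum (fun t : ℕ => A * x ^ (t + 1)) (A * (x * (1 - x)⁻¹)) := by
    simpa only [pow_succ'] using
      ((hasSum_geometric_of_lt_one hx0 (by linarith)).mul_left x).mul_left A
  have hinv : (1 - x)⁻¹ ≤ 2 := by
    rw [inv_le_comm₀ (by linarith) (by norm_num)]
    linarith
  have hle : ∀ t : ℕ, ‖(aeval (x ^ d ^ t) P : ℝ) - 1‖ ≤ A * x ^ (t + 1) := fun t =>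
    (h _ (pow_nonneg hx0 _) (pow_le_one₀ hx0 (by linarith))).trans
      (mul_le_mul_of_nonneg_left (pow_pow_le_pow_succ hd hx0 (by linarith) t) hA)
  have hsum : Summable fun t : ℕ => ‖(aeval (x ^ d ^ t) P : ℝ) - 1‖ :=
    Summable.of_nonneg_of_le (fun _ => norm_nonneg _) hle hgeo.summable
  have hmul : Multipliable (fun t : ℕ => (aeval (x ^ d ^ t) P : ℝ)) := by
    simpa using multipliable_one_add_of_summable hsum
  refine ⟨hmul, ?_⟩
  have hlim := (hmul.hasProd.sub_const 1).norm
  refine le_of_tendsto hlim (Filter.Eventually.of_forall fun s => ?_)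
  have h1 := s.norm_prod_one_add_sub_one_le fun t : ℕ => (aeval (x ^ d ^ t) P : ℝ) - 1
  simp only [add_sub_cancel] at h1
  refine h1.trans ?_
  set y := ∑ t ∈ s, ‖(aeval (x ^ d ^ t) P : ℝ) - 1‖ with hy
  have hy0 : 0 ≤ y := Finset.sum_nonneg fun _ _ => norm_nonneg _
  have hy1 : y ≤ 2 * A * x := by
    calc y ≤ ∑ t ∈ s, A * x ^ (t + 1) := Finset.sum_le_sum fun t _ => hle t
      _ ≤ A * (x * (1 - x)⁻¹) := sum_le_hasSum s (fun _ _ => by positivity) hgeo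
      _ ≤ A * (x * 2) := by gcongr
      _ = 2 * A * x := by ring
  have hyA : y ≤ A := hy1.trans (by nlinarith)
  have hexp : Real.exp y - 1 ≤ y * Real.exp y := by
    have h2 := Real.add_one_le_exp (-y)
    have h3 := mul_le_mul_of_nonneg_right h2 (Real.exp_pos y).le
    rw [← Real.exp_add, neg_add_cancel, Real.exp_zero] at h3
    linarith
  calc Real.exp y - 1 ≤ y * Real.exp y := hexp
    _ ≤ (2 * A * x) * Real.exp A := by gcongr
    _ = 2 * A * Real.exp A * x := by ring

lemma prodFun_eq_mul {P : Polynomial ℚ} {d : ℕ} (hd : 2 ≤ d) (h0 : P.coeff 0 = 1)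
    {x : ℝ} (hx0 : 0 ≤ x) (hx1 : x ≤ 1 / 2) (k : ℕ) :
    prodFun P d x =
      (∏ t ∈ Finset.range k, (aeval (x ^ d ^ t) P : ℝ)) * prodFun P d (x ^ d ^ k) := by
  obtain ⟨C, -, h⟩ := multipliable_and_abs_prodFun_sub_one_le hd h0
  have hxk : x ^ d ^ k ≤ 1 / 2 := by
    refine le_trans ?_ hx1
    simpa using pow_le_pow_of_le_one hx0 (by linarith) (Nat.one_le_pow k d (by omega))
  have hm := (h (x ^ d ^ k) (pow_nonneg hx0 _) hxk).1
  have hs : (fun t : ℕ => (aeval ((x ^ d ^ k) ^ d ^ t) P : ℝ)) =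
      fun t => aeval (x ^ d ^ (t + k)) P := by
    funext t
    rw [← pow_mul, ← pow_add, add_comm]
  rw [hs] at hm
  rw [prodFun, prodFun, hs]
  exact (Multipliable.prod_mul_tprod_nat_mul' (f := fun t => (aeval (x ^ d ^ t) P : ℝ)) hm).symm

lemma aeval_partialProd (P : Polynomial ℚ) (d k : ℕ) (x : ℝ) :
    aeval x (partialProd P d k) = ∏ t ∈ Finset.range k, (aeval (x ^ d ^ t) P : ℝ) := by
  simp [partialProd, map_prod, aeval_comp]

lemma aeval_reflect_inv (r : Polynomial ℚ) {N : ℕ} (hN : r.natDegree ≤ N) {x : ℝ} (hx : x ≠ 0) :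
    aeval x⁻¹ (reflect N r) * x ^ N = aeval x r := by
  let _ : Invertible x := invertibleOfNonzero hx
  rw [aeval_def, aeval_def, ← eval₂_reflect_mul_pow _ x N r hN]
  simp

lemma exists_forall_abs_sub_prodFun_le {P : Polynomial ℚ} {d : ℕ} (hd : 2 ≤ d)
    (h0 : P.coeff 0 = 1) {p q : Polynomial ℚ} (hq : q ≠ 0) {m : ℕ} (hm : q.natDegree ≤ m)
    (happ : degB (xx⁻¹ * ((infProd P d : PowerSeries ℚ) : LaurentSeries ℚ) - pev p / pev q) ≤
      ((-(m : ℤ) : ℤ) : WithBot ℤ)) :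
    ∃ C : ℝ, 0 ≤ C ∧ ∀ z : ℝ, 2 ≤ z →
      |aeval z q * (z⁻¹ * prodFun P d z⁻¹) - aeval z p| ≤ C * z⁻¹ ^ (m - q.natDegree) := by
  set N := max p.natDegree q.natDegree
  set M := N - q.natDegree + m with hM
  have hNq : q.natDegree ≤ N := le_max_right _ _
  obtain ⟨R, hR⟩ := X_pow_dvd_of_degB_le hd h0 hq happ (N := N) (le_max_left _ _) hNq
  obtain ⟨C₁, hC₁, h₁⟩ := exists_forall_abs_aeval_le R
  obtain ⟨C₂, hC₂, h₂⟩ := exists_forall_abs_aeval_le (reflect N q * X * partialProd P d M)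
  obtain ⟨C₃, hC₃, h₃⟩ := multipliable_and_abs_prodFun_sub_one_le hd h0
  refine ⟨C₁ + C₂ * C₃, by positivity, fun z hz => ?_⟩
  have hz0 : z ≠ 0 := by linarith
  set x := z⁻¹ with hx
  have hx0 : 0 ≤ x := by positivity
  have hx1 : x ≤ 1 / 2 := by
    rw [hx, one_div]
    exact inv_anti₀ (by norm_num) hz
  have hx1' : x ≤ 1 := by linarith
  have hxM : x ^ d ^ M ≤ x ^ M :=
    pow_le_pow_of_le_one hx0 hx1' (Nat.lt_pow_self (by omega)).le
  have hxM' : x ^ d ^ M ≤ 1 / 2 := by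
    refine le_trans ?_ hx1
    simpa using pow_le_pow_of_le_one hx0 hx1' (Nat.one_le_pow M d (by omega))
  have hRx := congrArg (aeval x) hR
  simp only [map_sub, map_mul, aeval_X, map_pow] at hRx
  have hQx : aeval x (reflect N q * X * partialProd P d M) =
    aeval x (reflect N q) * x * aeval x (partialProd P d M) := by simp
  rw [← aeval_reflect_inv q hNq hz0, ← aeval_reflect_inv p (le_max_left _ _ : _ ≤ N) hz0,
    prodFun_eq_mul hd h0 hx0 hx1 M, ← aeval_partialProd]
  have key : aeval x (reflect N q) * z ^ N *
        (x * (aeval x (partialProd P d M) * prodFun P d (x ^ d ^ M))) -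
        aeval x (reflect N p) * z ^ N =
      (x ^ M * aeval x R + aeval x (reflect N q * X * partialProd P d M) *
        (prodFun P d (x ^ d ^ M) - 1)) * z ^ N := by
    rw [hQx, ← hRx]
    ring
  have hxz : x ^ M * z ^ N = x ^ (m - q.natDegree) := by
    have : M = (m - q.natDegree) + N := by omega
    rw [this, pow_add, mul_assoc, ← mul_pow, hx, inv_mul_cancel₀ hz0, one_pow, mul_one]
  rw [key, abs_mul, abs_of_nonneg (by positivity : (0 : ℝ) ≤ z ^ N), ← hxz, ← mul_assoc]
  refine mul_le_mul_of_nonneg_right ?_ (by positivity)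
  calc _ ≤ |x ^ M * aeval x R| + |aeval x (reflect N q * X * partialProd P d M) *
        (prodFun P d (x ^ d ^ M) - 1)| := abs_add_le _ _
    _ ≤ x ^ M * C₁ + C₂ * (C₃ * x ^ M) := by
        rw [abs_mul, abs_mul, abs_of_nonneg (pow_nonneg hx0 M)]
        gcongr
        · exact h₁ x hx0 hx1'
        · exact h₂ x hx0 hx1'
        · exact ((h₃ _ (pow_nonneg hx0 _) hxM').2).trans (by gcongr)
    _ = (C₁ + C₂ * C₃) * x ^ M := by ring

lemma intCast_eval_eq_aeval_map (r : Polynomial ℤ) (y : ℤ) :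
    ((r.eval y : ℤ) : ℝ) = aeval (y : ℝ) (r.map (Int.castRingHom ℚ)) := by
  rw [← algebraMap_int_eq, aeval_map_algebraMap]
  simpa using (aeval_algebraMap_apply ℝ y r).symm

lemma exists_int_polynomial_map_eq_C_mul (P : Polynomial ℚ) :
    ∃ (D : ℤ) (R : Polynomial ℤ), D ≠ 0 ∧ R.map (Int.castRingHom ℚ) = C (D : ℚ) * P := by
  obtain ⟨D, hD, h⟩ := IsLocalization.integerNormalization_spec (nonZeroDivisors ℤ) P
  refine ⟨D, IsLocalization.integerNormalization (nonZeroDivisors ℤ) P,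
    nonZeroDivisors.ne_zero hD, ?_⟩
  rw [← algebraMap_int_eq, h, ← smul_eq_C_mul, Int.cast_smul_eq_zsmul]

lemma exists_int_eq_mul_aeval_inv {P : Polynomial ℚ} {n : ℕ} (hn : P.natDegree ≤ n) :
    ∃ D : ℤ, D ≠ 0 ∧ ∀ y : ℤ, y ≠ 0 →
      ∃ m : ℤ, (m : ℝ) = D * ((y : ℝ) ^ n * aeval (y : ℝ)⁻¹ P) := by
  obtain ⟨D, R, hD, hR⟩ := exists_int_polynomial_map_eq_C_mul P
  refine ⟨D, hD, fun y hy => ⟨(reflect n R).eval y, ?_⟩⟩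
  have hy' : (y : ℝ) ≠ 0 := by exact_mod_cast hy
  have h1 := aeval_reflect_inv P hn (inv_ne_zero hy')
  rw [inv_inv] at h1
  rw [intCast_eval_eq_aeval_map, ← reflect_map, hR, reflect_C_mul, map_mul, aeval_C, ← h1, mul_left_comm _ _ (_ ^ n),
    ← mul_pow, mul_inv_cancel₀ hy']
  simp

lemma eventually_mul_pow_lt_pow_pow {d : ℕ} (hd : 2 ≤ d) {K B β : ℝ} (hK : 0 < K) (hB : 0 < B)
    (hβ : 1 < β) : ∀ᶠ k : ℕ in Filter.atTop, K * B ^ k < β ^ d ^ k := by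
  have hd1 : (1 : ℝ) < d := by exact_mod_cast hd
  have h0 := (tendsto_pow_const_div_const_pow_of_one_lt 0 hd1).const_mul (Real.log K)
  have h1 := (tendsto_pow_const_div_const_pow_of_one_lt 1 hd1).const_mul (Real.log B)
  have h := h0.add h1
  rw [mul_zero, mul_zero, add_zero] at h
  filter_upwards [h.eventually_lt_const (Real.log_pos hβ)] with k hk
  rw [← Real.log_lt_log_iff (by positivity) (by positivity), Real.log_mul hK.ne' (by positivity),
    Real.log_pow, Real.log_pow]
  have hdk : (0 : ℝ) < (d : ℝ) ^ k := by positivity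
  have := mul_lt_mul_of_pos_left hk hdk
  field_simp at this
  push_cast
  linarith

lemma exists_eventually_abs_aeval_bounds {q : Polynomial ℚ} (hq : q ≠ 0) :
    ∃ c C : ℝ, 0 < c ∧ 0 < C ∧ ∀ᶠ z : ℝ in Filter.atTop,
      c * z ^ q.natDegree ≤ |aeval z q| ∧ |aeval z q| ≤ C * z ^ q.natDegree := by
  set r : Polynomial ℝ := q.map (algebraMap ℚ ℝ) with hr
  have hr0 : r ≠ 0 := by simpa [hr, Polynomial.map_eq_zero] using hq
  have hdeg : r.natDegree = q.natDegree := natDegree_map _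
  have hl : 0 < |r.leadingCoeff| := abs_pos.mpr (leadingCoeff_ne_zero.mpr hr0)
  have hlim := (r.div_tendsto_atTop_leadingCoeff_div_of_degree_eq (X ^ q.natDegree) (by
    rw [degree_X_pow, degree_eq_natDegree hr0, hdeg])).abs
  simp only [leadingCoeff_X_pow, div_one, eval_pow, eval_X] at hlim
  refine ⟨|r.leadingCoeff| / 2, 2 * |r.leadingCoeff|, by positivity, by positivity, ?_⟩
  filter_upwards [hlim.eventually_const_lt (half_lt_self hl),
    hlim.eventually_lt_const (by linarith : |r.leadingCoeff| < 2 * |r.leadingCoeff|),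
    Filter.eventually_gt_atTop 0] with z h1 h2 hz
  have hz' : 0 < z ^ q.natDegree := by positivity
  have he : aeval z q = r.eval z := by rw [hr, eval_map_algebraMap]
  rw [abs_div, abs_of_pos hz'] at h1 h2
  rw [he]
  exact ⟨((lt_div_iff₀ hz').mp h1).le, ((div_lt_iff₀ hz').mp h2).le⟩

lemma prod_pow_mul_eq {d : ℕ} (hd : 2 ≤ d) (b : ℝ) (k : ℕ) :
    (∏ t ∈ Finset.range k, (b ^ d ^ t) ^ (d - 1)) * b = b ^ d ^ k := by
  induction k with
  | zero => simp
  | succ k ih =>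
    rw [Finset.prod_range_succ, mul_right_comm, ih, ← pow_succ', Nat.sub_add_cancel (by omega),
      ← pow_mul, pow_succ]

/-- The convergents of `g` at `b^{d^k}` give integers `a`, `s` with small `s g(b) - a`. -/
lemma exists_int_abs_mul_gval_sub_le {P : Polynomial ℚ} {d : ℕ} (hd : 2 ≤ d)
    (h0 : P.coeff 0 = 1) (hdeg : P.natDegree < d) {p q : Polynomial ℤ} (hq : q ≠ 0) {m : ℕ}
    (hm : q.natDegree ≤ m)
    (happ : degB (xx⁻¹ * ((infProd P d : PowerSeries ℚ) : LaurentSeries ℚ) -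
        pev (p.map (Int.castRingHom ℚ)) / pev (q.map (Int.castRingHom ℚ))) ≤
      ((-(m : ℤ) : ℤ) : WithBot ℤ)) {b : ℤ} (hb : 2 ≤ b) :
    ∃ (D : ℤ) (K : ℝ), D ≠ 0 ∧ 0 < K ∧ ∀ k : ℕ, ∃ a : ℤ,
      |((D ^ k * q.eval (b ^ d ^ k) : ℤ) : ℝ) * gval P d b - a| * ((b : ℝ) ^ d ^ k) ^ m ≤
        |(D : ℝ)| ^ k * K * ((b : ℝ) ^ d ^ k) ^ (q.natDegree + 1) := by
  have hb' : (2 : ℝ) ≤ b := by exact_mod_cast hb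
  have hb0 : (b : ℝ) ≠ 0 := by linarith
  have hx0 : (0 : ℝ) ≤ (b : ℝ)⁻¹ := by positivity
  have hx1 : (b : ℝ)⁻¹ ≤ 1 / 2 := by
    rw [one_div]
    exact inv_anti₀ (by norm_num) hb'
  have hinj : Function.Injective (Int.castRingHom ℚ) := Int.cast_injective
  have hqdeg : (q.map (Int.castRingHom ℚ)).natDegree = q.natDegree :=
    natDegree_map_eq_of_injective hinj q
  obtain ⟨C, hC, hCb⟩ := exists_forall_abs_sub_prodFun_le hd h0
    ((Polynomial.map_ne_zero_iff hinj).mpr hq) (hqdeg.trans_le hm) happ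
  rw [hqdeg] at hCb
  obtain ⟨D, hD, hDm⟩ := exists_int_eq_mul_aeval_inv (Nat.le_sub_one_of_lt hdeg)
  obtain ⟨_, _, hmul⟩ := multipliable_and_abs_prodFun_sub_one_le hd h0
  obtain ⟨B, hB⟩ := (hmul _ hx0 hx1).1.hasProd.tendsto_prod_nat.abs.bddAbove_range
  refine ⟨D, |B| * C + 1, hD, by positivity, fun k => ?_⟩
  choose f hf using fun t : ℕ => hDm (b ^ d ^ t) (pow_ne_zero _ (by omega))
  refine ⟨p.eval (b ^ d ^ k) * ∏ t ∈ Finset.range k, f t, ?_⟩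
  set z : ℝ := (b : ℝ) ^ d ^ k with hz
  set S : ℝ := ∏ t ∈ Finset.range k, (aeval ((b : ℝ)⁻¹ ^ d ^ t) P : ℝ) with hS
  have hz2 : 2 ≤ z := hb'.trans (by
    simpa using pow_le_pow_right₀ (by linarith : (1 : ℝ) ≤ b) (Nat.one_le_pow k d (by omega)))
  have hz0 : 0 < z := by linarith
  have hSB : |S| ≤ |B| := (hB ⟨k, rfl⟩).trans (le_abs_self B)
  have hprod : ((∏ t ∈ Finset.range k, f t : ℤ) : ℝ) = (D : ℝ) ^ k * (z * (b : ℝ)⁻¹ * S) := by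
    push_cast
    rw [Finset.prod_congr rfl fun t _ => hf t, Finset.prod_mul_distrib, Finset.prod_const,
      Finset.card_range, Finset.prod_mul_distrib, hz, ← prod_pow_mul_eq hd (b : ℝ) k,
      mul_inv_cancel_right₀ hb0, hS]
    push_cast
    simp only [inv_pow]
  have hg : gval P d b = (b : ℝ)⁻¹ * (S * prodFun P d z⁻¹) := by
    rw [hz, ← inv_pow, hS, ← prodFun_eq_mul hd h0 hx0 hx1 k]
    rfl
  have hdiff : ((D ^ k * q.eval (b ^ d ^ k) : ℤ) : ℝ) * gval P d b -
      ((p.eval (b ^ d ^ k) * ∏ t ∈ Finset.range k, f t : ℤ) : ℝ) =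
      (D : ℝ) ^ k * (z * (b : ℝ)⁻¹ * S) * (aeval z (q.map (Int.castRingHom ℚ)) *
        (z⁻¹ * prodFun P d z⁻¹) - aeval z (p.map (Int.castRingHom ℚ))) := by
    rw [Int.cast_mul, Int.cast_mul, hprod, intCast_eval_eq_aeval_map, intCast_eval_eq_aeval_map, hg, Int.cast_pow, Int.cast_pow, ← hz]
    field_simp
  have hzm : z⁻¹ ^ (m - q.natDegree) * z ^ m = z ^ q.natDegree := by
    have : z ^ m = z ^ (m - q.natDegree) * z ^ q.natDegree := by
      rw [← pow_add, Nat.sub_add_cancel hm]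
    rw [this, ← mul_assoc, ← mul_pow, inv_mul_cancel₀ hz0.ne', one_pow, one_mul]
  rw [hdiff, abs_mul, abs_mul, abs_mul, abs_mul, abs_pow, abs_of_pos hz0, abs_of_nonneg hx0]
  calc _ ≤ |(D : ℝ)| ^ k * (z * 1 * |B|) * (C * z⁻¹ ^ (m - q.natDegree)) * z ^ m := by
        gcongr
        · linarith
        · exact hCb z hz2
    _ = |(D : ℝ)| ^ k * (|B| * C) * (z * (z⁻¹ ^ (m - q.natDegree) * z ^ m)) := by ring
    _ = |(D : ℝ)| ^ k * (|B| * C) * z ^ (q.natDegree + 1) := by rw [hzm, pow_succ']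
    _ ≤ _ := by
        gcongr
        linarith

/-- Let `g(x) = x⁻¹∏_{t≥0} P(x^{-d^t})` with `P(0) = 1`, `deg P < d`,
`d ≥ 2`, and suppose `g` is badly approximable.  If integer polynomials `p, q` with
`deg q = n₀ ≥ 1` approximate `g` with rate `c ≥ 2`, i.e. `‖g - p/q‖ ≤ -2n₀ - c`, and
`b ≥ 2` is an integer with `g(b) ≠ 0` and `P(b^{-d^t}) ≠ 0` for all `t`, then the
irrationality exponent of `g(b)` is at least `2 + (c-1)/n₀`: for every `ε > 0` there are
infinitely many rationals `a/q'` with `|g(b) - a/q'| < q'^{-(2 + (c-1)/n₀ - ε)}`. -/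
theorem irrationality_exponent_lower_bound (P : Polynomial ℚ) (d : ℕ) (hd : 2 ≤ d)
    (h0 : P.coeff 0 = 1) (hdeg : P.natDegree < d)
    (hbad : ∃ C : ℤ, ∀ n, degB (cfA (xx⁻¹ * ((infProd P d : PowerSeries ℚ) :
      LaurentSeries ℚ)) n) ≤ (C : WithBot ℤ))
    (n₀ : ℕ) (hn₀ : 1 ≤ n₀) (c : ℕ) (hc : 2 ≤ c)
    (p q : Polynomial ℤ) (hqdeg : q.natDegree = n₀)
    (happ : degB (xx⁻¹ * ((infProd P d : PowerSeries ℚ) : LaurentSeries ℚ) -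
        pev (p.map (Int.castRingHom ℚ)) / pev (q.map (Int.castRingHom ℚ))) ≤
      (((-2 * (n₀ : ℤ) - (c : ℤ)) : ℤ) : WithBot ℤ))
    (b : ℤ) (hb : 2 ≤ b) (hgb : gval P d b ≠ 0)
    (hP : ∀ t : ℕ, (Polynomial.aeval (((b : ℝ))⁻¹ ^ d ^ t) P : ℝ) ≠ 0) :
    ∀ ε : ℝ, 0 < ε → ∀ Q : ℕ, ∃ (a : ℤ) (q' : ℕ), Q < q' ∧
      |gval P d b - (a : ℝ) / (q' : ℝ)| <
        (q' : ℝ) ^ (-(2 + ((c : ℝ) - 1) / (n₀ : ℝ)) + ε) := by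
  intro ε hε Q
  have hq : q ≠ 0 := by
    rintro rfl
    simp at hqdeg
    omega
  have hinj : Function.Injective (Int.castRingHom ℚ) := Int.cast_injective
  have hdegm : (q.map (Int.castRingHom ℚ)).natDegree = n₀ :=
    (natDegree_map_eq_of_injective hinj q).trans hqdeg
  obtain ⟨D, K, hD, hK, happrox⟩ := exists_int_abs_mul_gval_sub_le hd h0 hdeg (p := p) hq
    (m := 2 * n₀ + c) (by omega) (happ.trans_eq (by push_cast; congr 1; ring)) hb
  obtain ⟨c₁, C₁, hc₁, hC₁, hbounds⟩ :=
    exists_eventually_abs_aeval_bounds ((Polynomial.map_ne_zero_iff hinj).mpr hq)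
  rw [hdegm] at hbounds
  rw [hqdeg] at happrox
  set E : ℝ := 2 + ((c : ℝ) - 1) / (n₀ : ℝ) with hE
  have hb1 : (1 : ℝ) < b := by exact_mod_cast (by omega : 1 < b)
  have hn₀' : (0 : ℝ) < n₀ := by exact_mod_cast hn₀
  have hc' : (2 : ℝ) ≤ c := by exact_mod_cast hc
  have hE0 : 0 < E := by
    have : 0 ≤ ((c : ℝ) - 1) / n₀ := div_nonneg (by linarith) hn₀'.le
    linarith
  have hD1 : (1 : ℝ) ≤ |(D : ℝ)| := by exact_mod_cast Int.one_le_abs hD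
  have hD0 : (0 : ℝ) < |(D : ℝ)| := by linarith
  have hz_tendsto : Filter.Tendsto (fun k : ℕ => (b : ℝ) ^ d ^ k) Filter.atTop Filter.atTop :=
    (tendsto_pow_atTop_atTop_of_one_lt hb1).comp (tendsto_pow_atTop_atTop_of_one_lt (by omega))
  have hgrow := eventually_mul_pow_lt_pow_pow hd
    (K := K / c₁ * C₁ ^ E / c₁ ^ ε) (B := |(D : ℝ)| ^ E) (β := (b : ℝ) ^ ε)
    (by positivity) (by positivity) (Real.one_lt_rpow hb1 hε)
  obtain ⟨k, ⟨hlow, hupp⟩, hlt, hQk⟩ := ((hz_tendsto.eventually hbounds).and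
    (hgrow.and (hz_tendsto.eventually_gt_atTop (Q / c₁)))).exists
  obtain ⟨a, ha⟩ := happrox k
  set s : ℤ := D ^ k * q.eval (b ^ d ^ k) with hs
  set z : ℝ := (b : ℝ) ^ d ^ k with hz
  have hz1 : 1 ≤ z := one_le_pow₀ hb1.le
  have hz0 : 0 < z := by linarith
  have hzn : z ≤ z ^ n₀ := le_self_pow₀ hz1 (by omega)
  set v : ℝ := |aeval z (q.map (Int.castRingHom ℚ))| with hv
  have hsabs : ((s.natAbs : ℕ) : ℝ) = |(D : ℝ)| ^ k * v := by
    rw [Nat.cast_natAbs, Int.cast_abs, hs, hv, Int.cast_mul, abs_mul, Int.cast_pow, abs_pow,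
      intCast_eval_eq_aeval_map, Int.cast_pow]
  have hDk : 1 ≤ |(D : ℝ)| ^ k := one_le_pow₀ hD1
  have hvz : c₁ * z ≤ v := le_trans (by gcongr) hlow
  have hv0 : 0 < v := lt_of_lt_of_le (by positivity) hvz
  set r : ℝ := ((s.natAbs : ℕ) : ℝ) with hr
  have hzr : c₁ * z ≤ r := by
    rw [hsabs]
    exact hvz.trans (le_mul_of_one_le_left hv0.le hDk)
  have hr0 : 0 < r := lt_of_lt_of_le (by positivity) hzr
  have hs0 : (s : ℝ) ≠ 0 := by
    have : s ≠ 0 := by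
      intro h
      simp [hr, h] at hr0
    exact_mod_cast this
  have hrs : r = |(s : ℝ)| := by rw [hr, Nat.cast_natAbs, Int.cast_abs]
  refine ⟨s.sign * a, s.natAbs, ?_, ?_⟩
  · have : (Q : ℝ) < r := lt_of_lt_of_le ((div_lt_iff₀' hc₁).mp hQk) hzr
    exact Nat.cast_lt.mp this
  have hquot : ((s.sign * a : ℤ) : ℝ) / r = a / s := by
    rw [div_eq_div_iff hr0.ne' hs0]
    have h' : ((s.sign : ℤ) : ℝ) * s = r := by
      rw [hrs]
      exact_mod_cast Int.sign_mul_self_eq_abs s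
    rw [← h']
    push_cast
    ring
  rw [hquot]
  set e : ℝ := |gval P d b - a / s| with he
  have he0 : 0 ≤ e := abs_nonneg _
  have hse : |(s : ℝ) * gval P d b - a| = r * e := by
    rw [hrs, he, ← abs_mul, mul_sub, mul_div_cancel₀ _ hs0]
  have herr : e * z ^ (2 * n₀ + c - 1) ≤ K / c₁ := by
    rw [hse, hsabs] at ha
    have hpos : 0 < |(D : ℝ)| ^ k * z ^ (n₀ + 1) := by positivity
    rw [le_div_iff₀ hc₁]
    refine le_of_mul_le_mul_left ?_ hpos
    have hexp : z ^ (2 * n₀ + c) = z ^ (2 * n₀ + c - 1) * z := by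
      rw [← pow_succ]
      congr 1
      omega
    calc |(D : ℝ)| ^ k * z ^ (n₀ + 1) * (e * z ^ (2 * n₀ + c - 1) * c₁)
        = |(D : ℝ)| ^ k * (c₁ * z ^ n₀) * e * (z ^ (2 * n₀ + c - 1) * z) := by ring
      _ ≤ |(D : ℝ)| ^ k * v * e * (z ^ (2 * n₀ + c - 1) * z) := by gcongr
      _ = |(D : ℝ)| ^ k * v * e * z ^ (2 * n₀ + c) := by rw [hexp]
      _ ≤ |(D : ℝ)| ^ k * K * z ^ (n₀ + 1) := ha
      _ = |(D : ℝ)| ^ k * z ^ (n₀ + 1) * K := by ring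
  have hzE : (z ^ n₀) ^ E = z ^ (2 * n₀ + c - 1) := by
    rw [← Real.rpow_natCast, ← Real.rpow_natCast, ← Real.rpow_mul hz0.le]
    congr 1
    rw [hE, Nat.cast_sub (by omega)]
    push_cast
    field_simp
    ring
  have hrE : r ^ E ≤ (|(D : ℝ)| ^ E) ^ k * C₁ ^ E * z ^ (2 * n₀ + c - 1) := by
    calc r ^ E ≤ (|(D : ℝ)| ^ k * (C₁ * z ^ n₀)) ^ E := by
          rw [hsabs]
          gcongr
      _ = _ := by
          rw [Real.mul_rpow (by positivity) (by positivity),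
            Real.mul_rpow hC₁.le (by positivity), hzE, Real.rpow_pow_comm hD0.le, mul_assoc]
  have hrε : c₁ ^ ε * ((b : ℝ) ^ ε) ^ d ^ k ≤ r ^ ε := by
    rw [Real.rpow_pow_comm (by linarith), ← Real.mul_rpow hc₁.le hz0.le]
    gcongr
  rw [Real.rpow_add hr0, Real.rpow_neg hr0.le, inv_mul_eq_div, lt_div_iff₀ (by positivity)]
  calc e * r ^ E ≤ e * ((|(D : ℝ)| ^ E) ^ k * C₁ ^ E * z ^ (2 * n₀ + c - 1)) := by gcongr
    _ = (e * z ^ (2 * n₀ + c - 1)) * (C₁ ^ E * (|(D : ℝ)| ^ E) ^ k) := by ring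
    _ ≤ K / c₁ * (C₁ ^ E * (|(D : ℝ)| ^ E) ^ k) := by gcongr
    _ = c₁ ^ ε * (K / c₁ * C₁ ^ E / c₁ ^ ε * (|(D : ℝ)| ^ E) ^ k) := by field_simp
    _ < c₁ ^ ε * ((b : ℝ) ^ ε) ^ d ^ k := by gcongr
    _ ≤ r ^ ε := hrε

end
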